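/- arXiv:1009.0233 — 2 statements merged into one kernel-verified Lean document; each statement's English description precedes it below -/
import Mathlib

section
/- Let (σ, Λ) be a spectral pair with an enumeration (λ_k)_{k∈ℕ} of Λ. For a Schwartz function s on ℝ, let a(s) ∈ ℓ²(ℕ, ℂ) be the sequence a(s)_k = ∫_ℝ σ̂(y−λ_k) s(y) dy. Let f : ℝ → ℂ be a bounded Borel function and let (s_n)_{n∈ℕ} be a sequence of Schwartz functions such that sup_{u∈ℝ} |f(u) − ŝ_n(u)| → 0 as n → ∞. Then the sequence (a(s_n))_{n∈ℕ} converges in ℓ²(ℕ, ℂ), and its limit is the same for every sequence of Schwartz functions satisfying this uniform approximation property for f. (This defines Q_σ f as the limit of Q_σ s_n in L²(ℝ, dx).) -/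
open MeasureTheory Complex Filter

/-- The Fourier transform of a positive measure: `σ̂(x) = ∫ e^{ixu} dσ(u)`. -/
noncomputable def fourierT (σ : Measure ℝ) (x : ℝ) : ℂ :=
  ∫ u, Complex.exp (Complex.I * x * u) ∂σ

/-- The Fourier transform of a function: `ψ̂(u) = ∫ e^{iux} ψ(x) dx`. -/
noncomputable def ft (ψ : ℝ → ℂ) (u : ℝ) : ℂ :=
  ∫ x : ℝ, Complex.exp (Complex.I * u * x) * ψ x

/-- `(σ, Λ)` is a spectral pair: the family `e_λ(u) = e^{iλu}`, `λ ∈ Λ`, forms a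
Hilbert basis (complete orthonormal system) of `L²(σ)`. -/
def IsSpectralPair (σ : Measure ℝ) (Λ : Set ℝ) : Prop :=
  ∃ b : HilbertBasis Λ ℂ (Lp ℂ 2 σ),
    ∀ l : Λ, (b l : ℝ → ℂ) =ᵐ[σ] fun u => Complex.exp (Complex.I * (l : ℝ) * u)

/-- The sequence of coefficients `a(s)ₖ = ∫ σ̂(y − λₖ) s(y) dy` of `Q_σ s` in the
Hermite-function basis of `L²(ℝ, dx)`. -/
noncomputable def coeffSeq (σ : Measure ℝ) (lam : ℕ → ℝ) (s : ℝ → ℂ) (k : ℕ) : ℂ :=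
  ∫ y : ℝ, fourierT σ (y - lam k) * s y

/-- The coefficients `∫ e^{-iλₖu} g(u) dσ(u)` of `g` in the exponential system. -/
noncomputable def expCoeff (σ : Measure ℝ) (lam : ℕ → ℝ) (g : ℝ → ℂ) (k : ℕ) : ℂ :=
  ∫ u, Complex.exp (-(Complex.I * lam k * u)) * g u ∂σ

lemma norm_exp_I_mul_mul (x y : ℝ) : ‖Complex.exp (Complex.I * x * y)‖ = 1 := by
  have : Complex.I * x * y = ((x * y : ℝ) : ℂ) * Complex.I := by push_cast; ring
  rw [this, Complex.norm_exp_ofReal_mul_I]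

/-- Parseval's identity for the exponential coefficients of a function in `L²(σ)`. -/
lemma IsSpectralPair.hasSum_sq_norm_expCoeff {σ : Measure ℝ} {Λ : Set ℝ}
    (hsp : IsSpectralPair σ Λ) {lam : ℕ → ℝ} (hinj : Function.Injective lam)
    (hran : Set.range lam = Λ) {g : ℝ → ℂ} (hg : MemLp g 2 σ) :
    HasSum (fun k => ‖expCoeff σ lam g k‖ ^ 2) (‖hg.toLp g‖ ^ 2) := by
  obtain ⟨b, hb⟩ := hsp
  subst hran
  have h := lp.hasSum_norm (p := 2) (by norm_num) (b.repr (hg.toLp g))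
  rw [LinearIsometryEquiv.norm_map] at h
  have h' := (Equiv.ofInjective lam hinj).hasSum_iff.mpr h
  simp only [ENNReal.toReal_ofNat, Real.rpow_ofNat] at h'
  convert h' using 1
  funext k
  rw [Function.comp_apply]
  congr 2
  rw [b.repr_apply_apply, L2.inner_def]
  refine integral_congr_ae ?_
  filter_upwards [hb (Equiv.ofInjective lam hinj k), hg.coeFn_toLp] with u h1 h2
  rw [h1, h2, RCLike.inner_apply, ← Complex.exp_conj, mul_comm]
  simp

lemma stronglyMeasurable_ft {ψ : ℝ → ℂ} (hψ : Continuous ψ) : StronglyMeasurable (ft ψ) := by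
  unfold ft
  exact StronglyMeasurable.integral_prod_right
    (f := fun u x : ℝ => Complex.exp (Complex.I * u * x) * ψ x)
    (Continuous.stronglyMeasurable (by fun_prop))

lemma norm_ft_le (ψ : ℝ → ℂ) (u : ℝ) : ‖ft ψ u‖ ≤ ∫ x, ‖ψ x‖ := by
  refine (norm_integral_le_integral_norm _).trans_eq ?_
  simp only [norm_mul, norm_exp_I_mul_mul, one_mul]

lemma memLp_ft (σ : Measure ℝ) [IsFiniteMeasure σ] {ψ : ℝ → ℂ} (hψ : Continuous ψ) :
    MemLp (ft ψ) 2 σ :=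
  MemLp.of_bound (stronglyMeasurable_ft hψ).aestronglyMeasurable (∫ x, ‖ψ x‖)
    (ae_of_all _ (norm_ft_le ψ))

/-- By Fubini, the pairing of `ψ` with translates of `σ̂` is an exponential coefficient of `ψ̂`. -/
lemma coeffSeq_eq_expCoeff_ft (σ : Measure ℝ) [IsFiniteMeasure σ] (lam : ℕ → ℝ) {ψ : ℝ → ℂ}
    (hc : Continuous ψ) (hψ : Integrable ψ) :
    coeffSeq σ lam ψ = expCoeff σ lam (ft ψ) := by
  funext k
  have hint : Integrable (Function.uncurry fun y u : ℝ =>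
      Complex.exp (Complex.I * (y - lam k : ℝ) * u) * ψ y) (volume.prod σ) := by
    refine Integrable.mono (hψ.comp_fst σ)
      (Continuous.aestronglyMeasurable (by fun_prop)) (ae_of_all _ ?_)
    rintro ⟨y, u⟩
    simp only [Function.uncurry_apply_pair, norm_mul, norm_exp_I_mul_mul, one_mul, le_refl]
  calc coeffSeq σ lam ψ k
      = ∫ y : ℝ, ∫ u : ℝ, Complex.exp (Complex.I * (y - lam k : ℝ) * u) * ψ y ∂σ := by
        simp only [coeffSeq, fourierT, integral_mul_const]
    _ = ∫ u : ℝ, (∫ y : ℝ, Complex.exp (Complex.I * (y - lam k : ℝ) * u) * ψ y) ∂σ :=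
        integral_integral_swap hint
    _ = expCoeff σ lam (ft ψ) k := by
        simp only [expCoeff, ft, ← integral_const_mul, ← mul_assoc, ← Complex.exp_add]
        refine integral_congr_ae (ae_of_all _ fun u => integral_congr_ae (ae_of_all _ fun y => ?_))
        simp only
        congr 2
        push_cast
        ring

lemma integrable_exp_mul {σ : Measure ℝ} {g : ℝ → ℂ} (hg : Integrable g σ) (l : ℝ) :
    Integrable (fun u : ℝ => Complex.exp (-(Complex.I * l * u)) * g u) σ := by
  refine hg.bdd_mul (c := 1) (Continuous.aestronglyMeasurable (by fun_prop))
    (ae_of_all _ fun u => ?_)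
  have := norm_exp_I_mul_mul (-l) u
  push_cast at this
  rw [← this]
  apply le_of_eq
  congr 2
  ring

lemma expCoeff_sub (σ : Measure ℝ) (lam : ℕ → ℝ) {g h : ℝ → ℂ} (hg : Integrable g σ)
    (hh : Integrable h σ) (k : ℕ) :
    expCoeff σ lam (g - h) k = expCoeff σ lam g k - expCoeff σ lam h k := by
  rw [expCoeff, expCoeff, expCoeff,
    ← integral_sub (integrable_exp_mul hg _) (integrable_exp_mul hh _)]
  simp only [Pi.sub_apply, mul_sub]

lemma IsSpectralPair.memℓp_expCoeff {σ : Measure ℝ} {Λ : Set ℝ}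
    (hsp : IsSpectralPair σ Λ) {lam : ℕ → ℝ} (hinj : Function.Injective lam)
    (hran : Set.range lam = Λ) {g : ℝ → ℂ} (hg : MemLp g 2 σ) :
    Memℓp (expCoeff σ lam g) 2 := by
  refine memℓp_gen ?_
  simpa using (hsp.hasSum_sq_norm_expCoeff hinj hran hg).summable

/-- Uniform convergence implies convergence in `L²` of a finite measure. -/
lemma tendsto_norm_toLp_sub_of_tendstoUniformly {σ : Measure ℝ} [IsFiniteMeasure σ]
    {F : ℕ → ℝ → ℂ} {f : ℝ → ℂ} (h : TendstoUniformly F f atTop)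
    (hF : ∀ n, MemLp (F n) 2 σ) (hf : MemLp f 2 σ) :
    Tendsto (fun n => ‖((hF n).sub hf).toLp (F n - f)‖) atTop (nhds 0) := by
  set M : ℝ := (σ.real Set.univ) ^ ((2 : ENNReal).toReal)⁻¹ with hM
  have hM0 : 0 ≤ M := by positivity
  rw [Metric.tendsto_atTop]
  intro ε hε
  obtain ⟨N, hN⟩ := eventually_atTop.mp
    (Metric.tendstoUniformly_iff.mp h (ε / (M + 1)) (by positivity))
  refine ⟨N, fun n hn => ?_⟩
  rw [dist_zero_right, norm_norm]
  have hle := Lp.norm_le_of_ae_bound (f := ((hF n).sub hf).toLp (F n - f))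
    (C := ε / (M + 1)) (by positivity) (by
      filter_upwards [((hF n).sub hf).coeFn_toLp] with u hu
      rw [hu, Pi.sub_apply, ← dist_eq_norm, dist_comm]
      exact (hN n hn u).le)
  refine hle.trans_lt ?_
  have : M * (ε / (M + 1)) < ε := by
    rw [← mul_div_assoc, div_lt_iff₀ (by positivity)]
    nlinarith
  simpa only [hM, measureReal_def, ← coe_measureUnivNNReal, ENNReal.coe_toReal] using this

theorem stmt8 (σ : Measure ℝ) [IsFiniteMeasure σ] (Λ : Set ℝ)
    (hsp : IsSpectralPair σ Λ)
    (lam : ℕ → ℝ) (hinj : Function.Injective lam) (hran : Set.range lam = Λ)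
    (f : ℝ → ℂ) (hfm : Measurable f) (hfb : ∃ C : ℝ, ∀ u : ℝ, ‖f u‖ ≤ C)
    (s : ℕ → SchwartzMap ℝ ℂ)
    (hs : TendstoUniformly (fun n u => ft (⇑(s n)) u) f atTop) :
    ∃ L : ℕ → ℂ, Memℓp L 2 ∧
      ∀ t : ℕ → SchwartzMap ℝ ℂ,
        TendstoUniformly (fun n u => ft (⇑(t n)) u) f atTop →
        (∀ n, Memℓp (coeffSeq σ lam (⇑(t n))) 2) ∧
        Tendsto (fun n => ∑' k : ℕ, ‖coeffSeq σ lam (⇑(t n)) k - L k‖ ^ 2)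
          atTop (nhds 0) := by
  obtain ⟨C, hC⟩ := hfb
  have hf : MemLp f 2 σ := MemLp.of_bound hfm.aestronglyMeasurable C (ae_of_all _ hC)
  refine ⟨expCoeff σ lam f, hsp.memℓp_expCoeff hinj hran hf, fun t ht => ?_⟩
  have hF : ∀ n, MemLp (ft (t n)) 2 σ := fun n => memLp_ft σ (t n).continuous
  have hcoeff : ∀ n, coeffSeq σ lam (t n) = expCoeff σ lam (ft (t n)) := fun n =>
    coeffSeq_eq_expCoeff_ft σ lam (t n).continuous (t n).integrable
  refine ⟨fun n => hcoeff n ▸ hsp.memℓp_expCoeff hinj hran (hF n), ?_⟩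
  have key : ∀ n, ∑' k, ‖coeffSeq σ lam (t n) k - expCoeff σ lam f k‖ ^ 2 =
      ‖((hF n).sub hf).toLp (ft (t n) - f)‖ ^ 2 := fun n => by
    rw [← (hsp.hasSum_sq_norm_expCoeff hinj hran ((hF n).sub hf)).tsum_eq]
    simp only [hcoeff, expCoeff_sub σ lam ((hF n).integrable one_le_two)
      (hf.integrable one_le_two)]
  simpa only [key, ne_eq, OfNat.ofNat_ne_zero, not_false_eq_true, zero_pow] using
    (tendsto_norm_toLp_sub_of_tendstoUniformly ht hF hf).pow 2
end

section
/- Let (σ, Λ) be a spectral pair with σ a probability measure whose support is contained in [−1/2, 1/2]. Then for all t, s ∈ ℝ with t ≠ s, ∑_{λ∈Λ} | (1/(t−s)) ∫_s^t σ̂(y−λ) dy − σ̂(t−λ) |² ≤ (t−s)²/3. (This establishes that the process X_σ(t) = ∑_λ (∫_0^t σ̂(y−λ) dy) Z_λ is differentiable in the white noise space norm, with derivative W_σ(t) = ∑_λ σ̂(t−λ) Z_λ.) -/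
open MeasureTheory Complex

/-- The error made when `e^{itu}` is replaced by the mean of `e^{iyu}` over `y ∈ [s, t]`. -/
noncomputable def expMeanError (t s u : ℝ) : ℂ :=
  (1 / (t - s) : ℂ) * (∫ y in s..t, cexp (I * y * u)) - cexp (I * t * u)

theorem norm_exp_I_mul (y u : ℝ) : ‖cexp (I * y * u)‖ = 1 := by
  rw [mul_assoc, ← ofReal_mul, mul_comm, norm_exp_ofReal_mul_I]

theorem norm_exp_I_mul_sub_le (y t u : ℝ) :
    ‖cexp (I * y * u) - cexp (I * t * u)‖ ≤ |y - t| * |u| := by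
  have hfactor : cexp (I * y * u) - cexp (I * t * u)
      = cexp (I * t * u) * (cexp (I * ((y - t) * u : ℝ)) - 1) := by
    rw [mul_sub, ← Complex.exp_add, mul_one]
    congr 2
    push_cast
    ring
  rw [hfactor, norm_mul, norm_exp_I_mul, one_mul, ← abs_mul]
  exact Real.norm_exp_I_mul_ofReal_sub_one_le

theorem continuous_expMeanError (t s : ℝ) : Continuous (expMeanError t s) := by
  have hint : Continuous fun u : ℝ => ∫ y in s..t, cexp (I * y * u) :=
    intervalIntegral.continuous_parametric_intervalIntegral_of_continuous'
      (f := fun u y : ℝ => cexp (I * y * u)) (by fun_prop) s t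
  unfold expMeanError
  fun_prop

theorem norm_expMeanError_le {t s : ℝ} (hts : t ≠ s) (u : ℝ) :
    ‖expMeanError t s u‖ ≤ |t - s| * |u| := by
  have hne : (t - s : ℂ) ≠ 0 := by
    exact_mod_cast sub_ne_zero.2 hts
  have hmean : expMeanError t s u
      = (1 / (t - s) : ℂ) * ∫ y in s..t, (cexp (I * y * u) - cexp (I * t * u)) := by
    rw [intervalIntegral.integral_sub
      ((by fun_prop : Continuous fun y : ℝ => cexp (I * y * u)).intervalIntegrable _ _)
      (by simp), intervalIntegral.integral_const, real_smul, expMeanError,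
      mul_sub, ← mul_assoc, ofReal_sub, one_div_mul_cancel hne, one_mul]
  have hbound : ‖∫ y in s..t, (cexp (I * y * u) - cexp (I * t * u))‖
      ≤ (|t - s| * |u|) * |t - s| := by
    refine intervalIntegral.norm_integral_le_of_norm_le_const fun y hy => ?_
    refine (norm_exp_I_mul_sub_le y t u).trans
      (mul_le_mul_of_nonneg_right ?_ (abs_nonneg u))
    rw [abs_sub_comm]
    exact Set.abs_sub_right_of_mem_uIcc (Set.uIoc_subset_uIcc hy)
  have hpos : 0 < |t - s| := abs_pos.2 (sub_ne_zero.2 hts)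
  have hnorm : ‖(1 / (t - s) : ℂ)‖ = |t - s|⁻¹ := by
    rw [norm_div, norm_one, one_div, ← ofReal_sub, norm_real, Real.norm_eq_abs]
  rw [hmean, norm_mul, hnorm, inv_mul_le_iff₀ hpos]
  linarith

theorem integrable_exp_I_mul (σ : Measure ℝ) [IsFiniteMeasure σ] (y : ℝ) :
    Integrable (fun u : ℝ => cexp (I * y * u)) σ :=
  .of_bound (by fun_prop) 1 (.of_forall fun u => (norm_exp_I_mul y u).le)

theorem integral_fourierT_sub (σ : Measure ℝ) [IsFiniteMeasure σ] (t s l : ℝ) :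
    ∫ y in s..t, fourierT σ (y - l)
      = ∫ u, (∫ y in s..t, cexp (I * (y - l : ℝ) * u)) ∂σ := by
  unfold fourierT
  have : IsFiniteMeasure (volume.restrict (Set.uIoc s t)) := ⟨by simp [Set.uIoc]⟩
  refine intervalIntegral_integral_swap
    (f := fun y u : ℝ => cexp (I * (y - l : ℝ) * u)) ?_
  refine .of_bound (by unfold Function.uncurry; fun_prop) 1
    (.of_forall fun p => (norm_exp_I_mul (p.1 - l) p.2).le)

theorem mean_fourierT_sub_eq_integral (σ : Measure ℝ) [IsFiniteMeasure σ] (t s l : ℝ) :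
    (1 / (t - s) : ℂ) * (∫ y in s..t, fourierT σ (y - l)) - fourierT σ (t - l)
      = ∫ u, cexp (-(I * l * u)) * expMeanError t s u ∂σ := by
  have hint : Integrable (fun u : ℝ => ∫ y in s..t, cexp (I * (y - l : ℝ) * u)) σ := by
    refine .of_bound (C := 1 * |t - s|) (Continuous.aestronglyMeasurable ?_) (.of_forall fun u =>
      intervalIntegral.norm_integral_le_of_norm_le_const fun y _ => (norm_exp_I_mul (y - l) u).le)
    exact intervalIntegral.continuous_parametric_intervalIntegral_of_continuous'
      (f := fun u y : ℝ => cexp (I * (y - l : ℝ) * u)) (by fun_prop) s t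
  rw [integral_fourierT_sub, ← integral_const_mul, fourierT,
    ← integral_sub (hint.const_mul _) (integrable_exp_I_mul σ (t - l))]
  have hshift (y u : ℝ) :
      cexp (I * (y - l : ℝ) * u) = cexp (-(I * l * u)) * cexp (I * y * u) := by
    rw [← Complex.exp_add]
    push_cast
    ring_nf
  congr 1 with u
  simp_rw [hshift, intervalIntegral.integral_const_mul, expMeanError]
  ring

theorem stmt12 (σ : Measure ℝ) [IsProbabilityMeasure σ]
    (hsupp : σ (Set.Icc (-(1/2) : ℝ) (1/2))ᶜ = 0)
    (Λ : Set ℝ) (hΛ : Λ.Countable) (h : IsSpectralPair σ Λ)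
    (t s : ℝ) (hts : t ≠ s) :
    Summable (fun l : Λ =>
      ‖(1 / (t - s) : ℂ) * (∫ y in s..t, fourierT σ (y - (l : ℝ)))
        - fourierT σ (t - (l : ℝ))‖ ^ 2) ∧
    ∑' l : Λ,
        ‖(1 / (t - s) : ℂ) * (∫ y in s..t, fourierT σ (y - (l : ℝ)))
          - fourierT σ (t - (l : ℝ))‖ ^ 2
      ≤ (t - s) ^ 2 / 3 := by
  obtain ⟨b, hb⟩ := h
  have hsupp' : ∀ᵐ u ∂σ, |u| ≤ 1 / 2 := by
    filter_upwards [mem_ae_iff.2 hsupp] with u hu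
    exact abs_le.2 hu
  have hbound : ∀ᵐ u ∂σ, ‖expMeanError t s u‖ ≤ |t - s| * (1 / 2) := by
    filter_upwards [hsupp'] with u hu
    exact (norm_expMeanError_le hts u).trans (by gcongr)
  have hmem : MemLp (expMeanError t s) 2 σ :=
    .of_bound (continuous_expMeanError t s).aestronglyMeasurable _ hbound
  have hcoeff (l : Λ) :
      (1 / (t - s) : ℂ) * (∫ y in s..t, fourierT σ (y - (l : ℝ))) - fourierT σ (t - (l : ℝ))
        = inner ℂ (b l) (hmem.toLp _) := by
    rw [mean_fourierT_sub_eq_integral, L2.inner_def]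
    refine integral_congr_ae ?_
    filter_upwards [hb l, hmem.coeFn_toLp] with u hu hv
    rw [hu, hv, RCLike.inner_apply, ← Complex.exp_conj]
    simp [mul_comm]
  have hnorm : ‖hmem.toLp _‖ ≤ |t - s| * (1 / 2) := by
    have := Lp.norm_le_of_ae_bound (f := hmem.toLp _) (C := |t - s| * (1 / 2))
      (by positivity) (by
      filter_upwards [hbound, hmem.coeFn_toLp] with u hu hv
      rwa [hv])
    simpa [measureUnivNNReal] using this
  simp_rw [hcoeff]
  refine ⟨b.orthonormal.inner_products_summable _,
    (b.orthonormal.tsum_inner_products_le _).trans ?_⟩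
  calc ‖hmem.toLp _‖ ^ 2 ≤ (|t - s| * (1 / 2)) ^ 2 := by gcongr
    _ = (t - s) ^ 2 / 4 := by rw [mul_pow, sq_abs]; ring
    _ ≤ (t - s) ^ 2 / 3 := by nlinarith [sq_nonneg (t - s)]
end
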